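/- Let X be an atomistic Dacey space of at most countable rank such that C(X) has the covering property, and let (A, B) be a decomposition of X, i.e., A and B are orthoclosed with A = B^⊥ and B = A^⊥. Then the rank of X equals the (cardinal) sum of the rank of A and the rank of B. -/

import Mathlib

class Orthoset (X : Type*) extends Zero X where
  perp : X → X → Prop
  perp_comm : ∀ x y : X, perp x y → perp y x
  perp_self : ∀ x : X, perp x x → x = 0
  zero_perp : ∀ x : X, perp 0 x

namespace Orthoset

variable {X : Type*} [Orthoset X]

/-- The orthocomplement of a subset of an orthoset. -/
def ortho (A : Set X) : Set X := {x : X | ∀ y ∈ A, perp x y}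

/-- A subset is orthoclosed if it equals its double orthocomplement. -/
def Orthoclosed (A : Set X) : Prop := ortho (ortho A) = A

/-- `X` is a Dacey space: `C(X)` is orthomodular. -/
def IsDacey (X : Type*) [Orthoset X] : Prop :=
  ∀ A B : Set X, Orthoclosed A → Orthoclosed B → B ⊆ A →
    A = ortho (ortho (B ∪ (A ∩ ortho B)))

/-- `X` is atomistic: for proper `x, y`, `{x}^⊥ ⊆ {y}^⊥` implies `{x}^⊥ = {y}^⊥`. -/
def Atomistic (X : Type*) [Orthoset X] : Prop :=
  ∀ x y : X, x ≠ 0 → y ≠ 0 → ortho ({x} : Set X) ⊆ ortho ({y} : Set X) →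
    ortho ({x} : Set X) = ortho ({y} : Set X)

/-- `P` is an atom of the lattice `C(X)` of orthoclosed subsets. -/
def IsAtomC (X : Type*) [Orthoset X] (P : Set X) : Prop :=
  Orthoclosed P ∧ P ≠ {0} ∧
    ∀ Q : Set X, Orthoclosed Q → Q ⊆ P → Q = {0} ∨ Q = P

/-- `B` covers `A` in the lattice `C(X)` of orthoclosed subsets. -/
def CoversC {X : Type*} [Orthoset X] (A B : Set X) : Prop :=
  A ⊂ B ∧ ∀ C : Set X, Orthoclosed C → A ⊆ C → C ⊆ B → C = A ∨ C = B

/-- The lattice `C(X)` has the covering property. -/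
def CoveringProperty (X : Type*) [Orthoset X] : Prop :=
  ∀ A P : Set X, Orthoclosed A → IsAtomC X P → ¬ P ⊆ A →
    CoversC A (ortho (ortho (A ∪ P)))

/-- A `⊥`-set: a set of mutually orthogonal proper elements. -/
def PerpSet (D : Set X) : Prop :=
  (∀ x ∈ D, x ≠ 0) ∧ ∀ x ∈ D, ∀ y ∈ D, x ≠ y → perp x y

/-- The rank of a subset `A` of an orthoset: the supremum of the cardinalities of the
`⊥`-sets contained in `A`. -/
noncomputable def rankOf (A : Set X) : Cardinal :=
  sSup {c : Cardinal | ∃ D : Set X, PerpSet D ∧ D ⊆ A ∧ c = Cardinal.mk D}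

end Orthoset

open Orthoset


namespace Orthoset

variable {X : Type*} [Orthoset X]

theorem zero_mem_ortho (S : Set X) : (0 : X) ∈ ortho S := fun y _ => zero_perp y

theorem ortho_anti {S T : Set X} (h : S ⊆ T) : ortho T ⊆ ortho S :=
  fun _ hx y hy => hx y (h hy)

theorem subset_cl (S : Set X) : S ⊆ ortho (ortho S) :=
  fun _ hx _ hy => perp_comm _ _ (hy _ hx)

theorem ortho_cl (S : Set X) : ortho (ortho (ortho S)) = ortho S :=
  Set.Subset.antisymm (ortho_anti (subset_cl S)) (subset_cl _)

theorem cl_le {S T : Set X} (h : S ⊆ ortho (ortho T)) : ortho (ortho S) ⊆ ortho (ortho T) := by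
  have := ortho_anti (ortho_anti h)
  rwa [ortho_cl (ortho T)] at this

theorem isAtomC_cl (hatom : Atomistic X) {s : X} (hs : s ≠ 0) :
    IsAtomC X (ortho (ortho {s})) := by
  refine ⟨ortho_cl _, ?_, ?_⟩
  · intro h
    have : s ∈ ortho (ortho ({s} : Set X)) := subset_cl _ rfl
    rw [h] at this
    exact hs this
  · intro Q hQ hQs
    by_cases hq : ∃ q ∈ Q, q ≠ 0
    · right
      obtain ⟨q, hq, hq0⟩ := hq
      refine Set.Subset.antisymm hQs ?_
      have h1 : ortho ({s} : Set X) ⊆ ortho {q} := by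
        rintro x hx y rfl
        exact perp_comm _ _ (hQs hq x hx)
      rw [hatom s q hs hq0 h1, ← hQ]
      apply ortho_anti
      apply ortho_anti
      simpa using hq
    · left
      push Not at hq
      refine Set.Subset.antisymm hq ?_
      rintro x rfl
      rw [← hQ]
      exact zero_mem_ortho _

theorem exchange (hatom : Atomistic X) (hcov : CoveringProperty X) {S : Set X} {s t : X}
    (h1 : t ∉ ortho (ortho S)) (h2 : t ∈ ortho (ortho (insert s S))) :
    s ∈ ortho (ortho (insert t S)) := by
  have hsS : s ∉ ortho (ortho S) := by
    intro h
    exact h1 (cl_le (Set.insert_subset h (subset_cl S)) h2)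
  have hs0 : s ≠ 0 := by
    rintro rfl
    exact hsS (zero_mem_ortho _)
  have hss : s ∈ ortho (ortho ({s} : Set X)) := subset_cl _ rfl
  have hc := hcov (ortho (ortho S)) _ (ortho_cl _) (isAtomC_cl hatom hs0) (fun h => hsS (h hss))
  have hS : S ⊆ insert t S := Set.subset_insert _ _
  have hle : insert t S ⊆ ortho (ortho (ortho (ortho S) ∪ ortho (ortho {s}))) := by
    refine Set.insert_subset ?_ ?_
    · refine ortho_anti (ortho_anti ?_) h2
      exact Set.insert_subset (Or.inr hss) (fun x hx => Or.inl (subset_cl _ hx))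
    · exact fun x hx => subset_cl _ (Or.inl (subset_cl _ hx))
  rcases hc.2 (ortho (ortho (insert t S))) (ortho_cl _) (ortho_anti (ortho_anti hS))
    (cl_le hle) with h | h
  · exact absurd (h ▸ subset_cl _ (Set.mem_insert t S)) h1
  · rw [h]
    exact subset_cl _ (Or.inr hss)

open Classical in
theorem steinitz (hatom : Atomistic X) (hcov : CoveringProperty X) (T : Finset X)
    (hT : PerpSet (T : Set X)) (n : ℕ) : ∀ S : Finset X, (S \ T).card = n →
      (T : Set X) ⊆ ortho (ortho (S : Set X)) → T.card ≤ S.card := by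
  induction n with
  | zero =>
    intro S hS hTS
    have hsub : S ⊆ T := by simpa using hS
    apply Finset.card_le_card
    intro t ht
    by_contra htS
    have : t ∈ ortho (S : Set X) := by
      intro y hy
      refine hT.2 t ht y (hsub hy) ?_
      rintro rfl
      exact htS hy
    exact hT.1 t ht (perp_self _ (hTS ht t this))
  | succ n ih =>
    intro S hS hTS
    obtain ⟨s, hs⟩ : (S \ T).Nonempty := by
      rw [← Finset.card_pos]; omega
    have hsS := (Finset.mem_sdiff.1 hs).1
    have hsT := (Finset.mem_sdiff.1 hs).2
    have hc : (S.erase s \ T).card = n := by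
      rw [Finset.erase_sdiff_comm, Finset.card_erase_of_mem hs]; omega
    have hins : (S : Set X) = insert s ((S.erase s : Finset X) : Set X) := by
      rw [← Finset.coe_insert, Finset.insert_erase hsS]
    by_cases h : (T : Set X) ⊆ ortho (ortho ((S.erase s : Finset X) : Set X))
    · exact (ih _ hc h).trans (Finset.card_le_card (Finset.erase_subset _ _))
    · obtain ⟨t, ht, htn⟩ := Set.not_subset.1 h
      have h2 := exchange hatom hcov htn (hins ▸ hTS ht)
      refine (ih (insert t (S.erase s)) ?_ ?_).trans ?_
      · rw [Finset.insert_sdiff_of_mem _ (by simpa using ht)]; exact hc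
      · refine hTS.trans (cl_le ?_)
        rw [hins, Finset.coe_insert]
        exact Set.insert_subset h2 (fun x hx => subset_cl _ (Or.inr hx))
      · refine (Finset.card_insert_le _ _).trans ?_
        rw [Finset.card_erase_add_one hsS]

theorem exists_basis (hdacey : IsDacey X) {A : Set X} (hA : Orthoclosed A) :
    ∃ D : Set X, PerpSet D ∧ D ⊆ A ∧ ortho (ortho D) = A := by
  obtain ⟨D, hD⟩ := zorn_subset {D : Set X | PerpSet D ∧ D ⊆ A} (by
    intro c hc hchain
    refine ⟨⋃₀ c, ⟨⟨?_, ?_⟩, ?_⟩, fun s hs => Set.subset_sUnion_of_mem hs⟩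
    · rintro x ⟨s, hs, hx⟩
      exact (hc hs).1.1 x hx
    · rintro x ⟨s, hs, hx⟩ y ⟨t, ht, hy⟩ hxy
      rcases hchain.total hs ht with h | h
      · exact (hc ht).1.2 x (h hx) y hy hxy
      · exact (hc hs).1.2 x hx y (h hy) hxy
    · exact Set.sUnion_subset fun s hs => (hc hs).2)
  obtain ⟨hDp, hDA⟩ := hD.prop
  refine ⟨D, hDp, hDA, ?_⟩
  have hcl : ortho (ortho D) ⊆ A := by
    have := ortho_anti (ortho_anti hDA)
    rwa [hA] at this
  refine Set.Subset.antisymm hcl ?_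
  rw [hdacey A _ hA (ortho_cl _) hcl]
  apply cl_le
  rintro x (hx | ⟨hxA, hx⟩)
  · exact hx
  · rw [ortho_cl] at hx
    by_cases hx0 : x = 0
    · rw [hx0]; exact zero_mem_ortho _
    have hmem : insert x D ∈ {D : Set X | PerpSet D ∧ D ⊆ A} := by
      refine ⟨⟨?_, ?_⟩, Set.insert_subset hxA hDA⟩
      · rintro y (rfl | hy)
        · exact hx0
        · exact hDp.1 y hy
      · rintro y (rfl | hy) z (rfl | hz) hyz
        · exact absurd rfl hyz
        · exact hx z hz
        · exact perp_comm _ _ (hx y hy)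
        · exact hDp.2 y hy z hz hyz
    exact subset_cl _ (hD.le_of_ge hmem (Set.subset_insert _ _) (Set.mem_insert _ _))

theorem bddAbove_rank (A : Set X) :
    BddAbove {c : Cardinal | ∃ D : Set X, PerpSet D ∧ D ⊆ A ∧ c = Cardinal.mk D} := by
  refine ⟨Cardinal.mk X, ?_⟩
  rintro c ⟨D, -, -, rfl⟩
  exact Cardinal.mk_set_le D

theorem le_rankOf {A D : Set X} (h : PerpSet D) (hD : D ⊆ A) : Cardinal.mk D ≤ rankOf A :=
  le_csSup (bddAbove_rank A) ⟨D, h, hD, rfl⟩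

theorem rankOf_le {A : Set X} {c : Cardinal}
    (h : ∀ D : Set X, PerpSet D → D ⊆ A → Cardinal.mk D ≤ c) : rankOf A ≤ c := by
  refine csSup_le ⟨_, ∅, ⟨?_, ?_⟩, Set.empty_subset _, rfl⟩ ?_
  · simp
  · simp
  · rintro c ⟨D, h1, h2, rfl⟩
    exact h D h1 h2

theorem rank_add_le {A B : Set X} (hAB : A = ortho B) :
    rankOf A + rankOf B ≤ rankOf (Set.univ : Set X) := by
  have key : ∀ D E : Set X, PerpSet D → PerpSet E → D ⊆ A → E ⊆ B →
      Cardinal.mk D + Cardinal.mk E ≤ rankOf (Set.univ : Set X) := by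
    intro D E hD hE hDA hEB
    have hp : ∀ x ∈ D, ∀ y ∈ E, perp x y := fun x hx y hy => by
      have := hDA hx
      rw [hAB] at this
      exact this y (hEB hy)
    rw [← Cardinal.mk_union_of_disjoint]
    · refine le_rankOf ⟨?_, ?_⟩ (Set.subset_univ _)
      · rintro x (hx | hx)
        · exact hD.1 x hx
        · exact hE.1 x hx
      · rintro x (hx | hx) y (hy | hy) hxy
        · exact hD.2 x hx y hy hxy
        · exact hp x hx y hy
        · exact perp_comm _ _ (hp y hy x hx)
        · exact hE.2 x hx y hy hxy
    · exact Set.disjoint_left.2 fun x hx hx' => hD.1 x hx (perp_self _ (hp x hx x hx'))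
  have e : ∀ A : Set X, rankOf A = ⨆ D : {D : Set X // PerpSet D ∧ D ⊆ A}, Cardinal.mk D.1 := by
    intro A
    unfold rankOf iSup
    congr 1
    ext c
    constructor
    · rintro ⟨D, h1, h2, rfl⟩
      exact ⟨⟨D, h1, h2⟩, rfl⟩
    · rintro ⟨⟨D, h1, h2⟩, rfl⟩
      exact ⟨D, h1, h2, rfl⟩
  have ne : ∀ A : Set X, Nonempty {D : Set X // PerpSet D ∧ D ⊆ A} := fun A =>
    ⟨⟨∅, ⟨by simp, by simp⟩, Set.empty_subset _⟩⟩
  have bd : ∀ A : Set X, BddAbove (Set.range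
      fun D : {D : Set X // PerpSet D ∧ D ⊆ A} => Cardinal.mk D.1) := by
    intro A
    refine ⟨Cardinal.mk X, ?_⟩
    rintro c ⟨D, rfl⟩
    exact Cardinal.mk_set_le D.1
  have := ne A
  have := ne B
  rw [e A, e B, Cardinal.ciSup_add_ciSup _ (bd A) _ (bd B)]
  exact ciSup_le fun D => ciSup_le fun E => key D.1 E.1 D.2.1 E.2.1 D.2.2 E.2.2

end Orthoset

/-- Let `X` be an atomistic Dacey space of at most countable rank such that `C(X)` has the
covering property, and let `(A, B)` be a decomposition of `X`, i.e. `A = B^⊥` and `B = A^⊥`.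
Then the rank of `X` is the cardinal sum of the rank of `A` and the rank of `B`. -/
theorem stmt6 {X : Type*} [Orthoset X]
    (hatom : Atomistic X) (hdacey : IsDacey X) (hcov : CoveringProperty X)
    (hcount : ∀ D : Set X, PerpSet D → Cardinal.mk D ≤ Cardinal.aleph0)
    (A B : Set X) (hAB : A = ortho B) (hBA : B = ortho A) :
    rankOf (Set.univ : Set X) = rankOf A + rankOf B := by
  refine le_antisymm ?_ (rank_add_le hAB)
  have hA : Orthoclosed A := by unfold Orthoclosed; rw [← hBA, ← hAB]
  have hB : Orthoclosed B := by unfold Orthoclosed; rw [← hAB, ← hBA]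
  obtain ⟨D, hD, hDA, hDc⟩ := exists_basis hdacey hA
  obtain ⟨E, hE, hEB, hEc⟩ := exists_basis hdacey hB
  refine rankOf_le fun F hF _ => ?_
  refine le_trans ?_ (add_le_add (le_rankOf hD hDA) (le_rankOf hE hEB))
  rcases le_or_gt Cardinal.aleph0 (Cardinal.mk D + Cardinal.mk E) with h | h
  · exact (hcount F hF).trans h
  classical
  obtain ⟨hDf, hEf⟩ := Cardinal.add_lt_aleph0_iff.1 h
  have hDf' : D.Finite := Cardinal.lt_aleph0_iff_set_finite.1 hDf
  have hEf' : E.Finite := Cardinal.lt_aleph0_iff_set_finite.1 hEf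
  lift D to Finset X using hDf'
  lift E to Finset X using hEf'
  have hspan : ∀ x, x ∈ ortho (ortho ((D ∪ E : Finset X) : Set X)) := by
    intro x y hy
    rw [Finset.coe_union] at hy
    have h1 : y ∈ ortho (ortho (ortho (D : Set X))) := by
      rw [ortho_cl]; exact ortho_anti Set.subset_union_left hy
    have h2 : y ∈ ortho (ortho (ortho (E : Set X))) := by
      rw [ortho_cl]; exact ortho_anti Set.subset_union_right hy
    rw [hDc] at h1
    rw [hEc, ← hAB] at h2
    have : y = 0 := perp_self _ (h1 y h2)
    rw [this]
    exact perp_comm _ _ (zero_perp _)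
  have hfin : ∀ T : Finset X, (T : Set X) ⊆ F → T.card ≤ D.card + E.card := by
    intro T hT
    refine (steinitz hatom hcov T ⟨fun x hx => hF.1 x (hT hx),
      fun x hx y hy => hF.2 x (hT hx) y (hT hy)⟩ _ (D ∪ E) rfl fun x _ => hspan x).trans ?_
    exact Finset.card_union_le _ _
  have hFf : F.Finite := by
    by_contra hinf
    obtain ⟨T, hT, hc⟩ := Set.Infinite.exists_subset_card_eq hinf (D.card + E.card + 1)
    have := hfin T hT
    omega
  lift F to Finset X using hFf
  have := hfin F subset_rfl
  simp only [Finset.coe_sort_coe, Cardinal.mk_coe_finset]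
  exact_mod_cast this
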